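/- In Version C, any position in which exactly one pile has odd size is an N-position, and any position in which exactly two piles have odd size is an N-position. -/

import Mathlib

/-- Remove one token from a pile of size `p` in `G`: delete one copy of `p` and,
if `p ≠ 1`, add back a pile of size `p - 1`. -/
def takeOne (G : Multiset ℕ) (p : ℕ) : Multiset ℕ :=
  G.erase p + (if p = 1 then (0 : Multiset ℕ) else {p - 1})

/-- Legal moves of Version C: remove one token from one chosen pile, or choose two
piles (counted with multiplicity) and remove one token from each of them
(piles reaching size 0 are deleted). -/
inductive MoveC : Multiset ℕ → Multiset ℕ → Prop
  | one {G : Multiset ℕ} {p : ℕ} (hp : p ∈ G) (h1 : 1 ≤ p) : MoveC G (takeOne G p)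
  | two {G : Multiset ℕ} {p q : ℕ} (hp : p ∈ G) (hq : q ∈ G.erase p)
      (h1 : 1 ≤ p) (h2 : 1 ≤ q) : MoveC G (takeOne (takeOne G p) q)

mutual
  /-- P-positions of Version C under normal play: every move leads to an N-position
  (in particular the empty position is a P-position).  Since every move strictly
  decreases the total number of tokens, this inductive definition agrees with the
  usual recursive definition of outcome classes. -/
  inductive PPosC : Multiset ℕ → Prop
    | mk : ∀ {G : Multiset ℕ}, (∀ H, MoveC G H → NPosC H) → PPosC G
  /-- N-positions of Version C under normal play: some move leads to a P-position. -/
  inductive NPosC : Multiset ℕ → Prop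
    | mk : ∀ {G H : Multiset ℕ}, MoveC G H → PPosC H → NPosC G
end

theorem zero_notMem_takeOne {G : Multiset ℕ} {p : ℕ} (hG : 0 ∉ G) (h1 : 1 ≤ p) :
    0 ∉ takeOne G p := by
  have h : 0 ∉ G.erase p := fun h => hG (Multiset.mem_of_mem_erase h)
  unfold takeOne
  split_ifs with hp
  · simpa using h
  · simp only [Multiset.mem_add, Multiset.mem_singleton, not_or]
    exact ⟨h, by omega⟩

theorem sum_takeOne_add_one {G : Multiset ℕ} {p : ℕ} (hp : p ∈ G) (h1 : 1 ≤ p) :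
    (takeOne G p).sum + 1 = G.sum := by
  obtain ⟨E, rfl⟩ := Multiset.exists_cons_of_mem hp
  unfold takeOne
  split_ifs with h
  · simp [h, add_comm]
  · simp only [Multiset.erase_cons_head, Multiset.sum_add, Multiset.sum_singleton,
      Multiset.sum_cons]
    omega

theorem countP_odd_takeOne_of_odd {G : Multiset ℕ} {p : ℕ} (hp : p ∈ G) (ho : Odd p) :
    (takeOne G p).countP (fun p => Odd p) + 1 = G.countP (fun p => Odd p) := by
  obtain ⟨E, rfl⟩ := Multiset.exists_cons_of_mem hp
  have h : ¬ Odd (p - 1) := by grind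
  unfold takeOne
  split_ifs with h1
  · simp [h1]
  · simp [← Multiset.cons_zero, ho, h]

theorem countP_odd_takeOne_of_not_odd {G : Multiset ℕ} {p : ℕ} (hp : p ∈ G) (h1 : 1 ≤ p)
    (he : ¬ Odd p) :
    (takeOne G p).countP (fun p => Odd p) = G.countP (fun p => Odd p) + 1 := by
  obtain ⟨E, rfl⟩ := Multiset.exists_cons_of_mem hp
  have h : Odd (p - 1) := by grind
  have hp1 : p ≠ 1 := by rintro rfl; exact he odd_one
  simp [takeOne, hp1, ← Multiset.cons_zero, he, h]

theorem mem_takeOne_of_mem_erase {G : Multiset ℕ} {p q : ℕ} (hq : q ∈ G.erase p) :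
    q ∈ takeOne G p :=
  Multiset.mem_add.2 (Or.inl hq)

/-- The outcome of a position of Version C with at most two odd piles. -/
theorem outcomeC_of_countP_odd (G : Multiset ℕ) (hG : 0 ∉ G) :
    (G.countP (fun p => Odd p) = 0 → PPosC G) ∧
    (G.countP (fun p => Odd p) = 1 → NPosC G) ∧
    (G.countP (fun p => Odd p) = 2 → NPosC G) := by
  induction hn : G.sum using Nat.strong_induction_on generalizing G with
  | _ n ih =>
    subst hn
    refine ⟨fun h => ⟨fun H hH => ?_⟩, fun h => ?_, fun h => ?_⟩
    · have hev : ∀ p ∈ G, ¬ Odd p := Multiset.countP_eq_zero.1 h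
      cases hH with
      | @one p hp h1 =>
        have hs := sum_takeOne_add_one hp h1
        have hc := countP_odd_takeOne_of_not_odd hp h1 (hev p hp)
        exact (ih _ (by omega) _ (zero_notMem_takeOne hG h1) rfl).2.1 (by omega)
      | @two p q hp hq h1 h2 =>
        have hq' := mem_takeOne_of_mem_erase hq
        have hs := sum_takeOne_add_one hp h1
        have hs' := sum_takeOne_add_one hq' h2
        have hc := countP_odd_takeOne_of_not_odd hp h1 (hev p hp)
        have hc' := countP_odd_takeOne_of_not_odd hq' h2
          (hev q (Multiset.mem_of_mem_erase hq))
        exact (ih _ (by omega) _ (zero_notMem_takeOne (zero_notMem_takeOne hG h1) h2)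
          rfl).2.2 (by omega)
    · obtain ⟨p, hp, ho⟩ := Multiset.countP_pos.1 (by omega : 0 < G.countP (fun p => Odd p))
      have hs := sum_takeOne_add_one hp ho.pos
      have hc := countP_odd_takeOne_of_odd hp ho
      exact ⟨.one hp ho.pos,
        (ih _ (by omega) _ (zero_notMem_takeOne hG ho.pos) rfl).1 (by omega)⟩
    · obtain ⟨p, hp, ho⟩ := Multiset.countP_pos.1 (by omega : 0 < G.countP (fun p => Odd p))
      have hE : 0 < (G.erase p).countP (fun p => Odd p) := by
        have hc := Multiset.countP_cons_of_pos (p := fun p => Odd p) (G.erase p) ho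
        rw [Multiset.cons_erase hp] at hc
        omega
      obtain ⟨q, hq, ho'⟩ := Multiset.countP_pos.1 hE
      have hq' := mem_takeOne_of_mem_erase hq
      have hs := sum_takeOne_add_one hp ho.pos
      have hs' := sum_takeOne_add_one hq' ho'.pos
      have hc := countP_odd_takeOne_of_odd hp ho
      have hc' := countP_odd_takeOne_of_odd hq' ho'
      exact ⟨.two hp hq ho.pos ho'.pos,
        (ih _ (by omega) _ (zero_notMem_takeOne (zero_notMem_takeOne hG ho.pos) ho'.pos)
          rfl).1 (by omega)⟩

/-- In Version C, any position with exactly one odd pile is an N-position, and any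
position with exactly two odd piles is an N-position. -/
theorem versionC_odd_NPos (G : Multiset ℕ) (hG : 0 ∉ G) :
    ((G.filter (fun p => Odd p)).card = 1 → NPosC G) ∧
    ((G.filter (fun p => Odd p)).card = 2 → NPosC G) := by
  simp only [← Multiset.countP_eq_card_filter]
  exact (outcomeC_of_countP_odd G hG).2
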